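/- Let u : ℝ → ℝ be an analytic even function and define f : ℝ³ → ℝ by f(x) = u(|x|). Then f is analytic, and for every r > 0 and q ∈ ℕ there exists a constant C = C(q) > 0 (independent of u and r ≤ 1) such that ‖f‖_{C^q(closed ball of radius r)} ≤ C · max{1, r^q} · ‖u‖_{C^{2q}([0,r])}. -/

import Mathlib

open MeasureTheory Real

lemma rab_sqrt {u : ℝ → ℝ} (hu : AnalyticAt ℝ u 0) (he : ∀ t : ℝ, u (-t) = u t) :
    ∃ g : ℝ → ℝ, AnalyticAt ℝ g 0 ∧ ∀ᶠ t in nhds (0:ℝ), u t = g (t ^ 2) := by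
  obtain ⟨p, R, hp⟩ := hu
  obtain ⟨ρ, hρ0, hρR⟩ := ENNReal.lt_iff_exists_nnreal_btwn.1 hp.r_pos
  have hρ : 0 < ρ := by exact_mod_cast hρ0
  obtain ⟨C, hC, hb⟩ := p.norm_mul_pow_le_of_lt_radius (hρR.trans_le hp.r_le)
  set c : ℕ → ℝ := fun n => p.coeff (2 * n) with hc
  set P := FormalMultilinearSeries.ofScalars ℝ c with hP
  have hrad : ((ρ ^ 2 : NNReal) : ENNReal) ≤ P.radius := by
    apply P.le_radius_of_bound C
    intro n
    have := hb (2 * n)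
    rw [hP, FormalMultilinearSeries.ofScalars_norm]
    rw [FormalMultilinearSeries.norm_apply_eq_norm_coef, pow_mul] at this
    simpa [hc] using this
  have hPpos : 0 < P.radius := lt_of_lt_of_le (by exact_mod_cast pow_pos hρ 2) hrad
  refine ⟨P.sum, (P.hasFPowerSeriesOnBall hPpos).analyticAt, ?_⟩
  filter_upwards [Metric.eball_mem_nhds (0:ℝ) hp.r_pos] with t ht
  have h1 := hp.hasSum ht
  have ht' : -t ∈ Metric.eball (0:ℝ) R := by
    simpa [Metric.mem_eball, edist_eq_enorm_sub] using ht
  have h2 := hp.hasSum ht'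
  simp only [zero_add, he] at h1 h2
  have h3 := (h1.add h2).mul_left (1/2 : ℝ)
  have h4 : HasSum (fun n => c n * (t ^ 2) ^ n) (1 / 2 * (u t + u t)) := by
    have hinj : Function.Injective (fun n : ℕ => 2 * n) := fun a b h => by simpa using h
    rw [← hinj.hasSum_iff] at h3
    · have hfe : (fun n => c n * (t ^ 2) ^ n) =
          ((fun i => 1 / 2 * (((p i) fun _ => t) + (p i) fun _ => -t)) ∘ fun n => 2 * n) := by
        funext n
        simp [hc, pow_mul]
        ring
      rw [hfe]
      exact h3
    · intro n hn
      have : Odd n := by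
        rw [← Nat.not_even_iff_odd]
        rintro ⟨k, hk⟩
        exact hn ⟨k, by simp; omega⟩
      simp [this.neg_pow]
  have h5 : P.sum (t ^ 2) = ∑' n, c n • (t ^ 2) ^ n :=
    FormalMultilinearSeries.ofScalars_sum_eq c (t ^ 2)
  simp only [smul_eq_mul] at h5
  rw [h5, h4.tsum_eq]
  ring

lemma rab_analytic {E : Type*} [NormedAddCommGroup E] [InnerProductSpace ℝ E]
    {u : ℝ → ℝ} (hu : ∀ x, AnalyticAt ℝ u x)
    (he : ∀ t : ℝ, u (-t) = u t) (x : E) : AnalyticAt ℝ (fun y : E => u ‖y‖) x := by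
  have hsq : AnalyticAt ℝ (fun y : E => ‖y‖ ^ 2) x := by
    have h : ContDiffAt ℝ ⊤ (fun y : E => ‖y‖ ^ 2) x := (contDiff_norm_sq ℝ).contDiffAt
    exact analyticWithinAt_univ.1 (contDiffWithinAt_omega_iff_analyticWithinAt.1 h.contDiffWithinAt)
  by_cases hx : x = 0
  · subst hx
    obtain ⟨g, hg, h⟩ := rab_sqrt (hu 0) he
    have h1 : AnalyticAt ℝ (fun y : E => g (‖y‖ ^ 2)) 0 :=
      AnalyticAt.fun_comp (by simpa using hg) hsq
    refine h1.congr ?_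
    have ht : Filter.Tendsto (fun y : E => ‖y‖) (nhds 0) (nhds 0) := by
      simpa using (continuous_norm (E := E)).tendsto 0
    filter_upwards [ht.eventually h] with y hy
    exact hy.symm
  · have hn : AnalyticAt ℝ (fun y : E => ‖y‖) x := by
      have h : ContDiffAt ℝ ⊤ (fun y : E => ‖y‖) x := contDiffAt_norm ℝ hx
      exact analyticWithinAt_univ.1
        (contDiffWithinAt_omega_iff_analyticWithinAt.1 h.contDiffWithinAt)
    exact AnalyticAt.fun_comp (hu _) hn

lemma rab_deriv_even {u : ℝ → ℝ} (he : ∀ t : ℝ, u (-t) = u t) (t : ℝ) :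
    deriv u (-t) = - deriv u t := by
  have h : (fun t => u (-t)) = u := funext he
  have := deriv_comp_neg u t
  rw [h] at this
  linarith

lemma rab_w {u : ℝ → ℝ} (hu : ∀ x, AnalyticAt ℝ u x) (he : ∀ t : ℝ, u (-t) = u t) :
    ∃ w : ℝ → ℝ, (∀ x, AnalyticAt ℝ w x) ∧ (∀ t, w (-t) = w t) ∧ ∀ t, t * w t = deriv u t := by
  have h0 : deriv u 0 = 0 := by
    have := rab_deriv_even he 0
    simp at this
    linarith
  have hmul : ∀ t, t * dslope (deriv u) 0 t = deriv u t := by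
    intro t
    have := sub_smul_dslope (deriv u) 0 t
    simpa [h0] using this
  refine ⟨dslope (deriv u) 0, ?_, ?_, hmul⟩
  · intro x
    by_cases hx : x = 0
    · subst hx
      obtain ⟨p, hp⟩ := (hu 0).deriv
      exact ⟨_, hp.has_fpower_series_dslope_fslope⟩
    · have h1 : AnalyticAt ℝ (fun t => deriv u t / t) x := (hu x).deriv.div analyticAt_id hx
      refine h1.congr ?_
      filter_upwards [isOpen_ne.mem_nhds hx] with t ht
      rw [← hmul t]
      field_simp
  · intro t
    by_cases ht : t = 0
    · simp [ht]
    · have h1 := hmul (-t)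
      rw [rab_deriv_even he, ← hmul t] at h1
      apply mul_left_cancel₀ ht
      linarith

lemma rab_hasDeriv {w : ℝ → ℝ} (hw : ∀ x, AnalyticAt ℝ w x) (n : ℕ) (t : ℝ) :
    HasDerivAt (iteratedDeriv n w) (iteratedDeriv (n+1) w t) t := by
  have hc : ContDiff ℝ (n+1) w := contDiff_iff_contDiffAt.2 fun x => (hw x).contDiffAt
  rw [iteratedDeriv_succ]
  exact (hc.differentiable_iteratedDeriv n (by exact_mod_cast Nat.lt_succ_self n) t).hasDerivAt

lemma rab_ode {u w : ℝ → ℝ} (hu : ∀ x, AnalyticAt ℝ u x) (hw : ∀ x, AnalyticAt ℝ w x)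
    (h : ∀ t, t * w t = deriv u t) (n : ℕ) : ∀ t, t * iteratedDeriv (n+1) w t +
      (n+1) * iteratedDeriv n w t = iteratedDeriv (n+2) u t := by
  induction n with
  | zero =>
    intro t
    have h1 := (hasDerivAt_id t).mul (rab_hasDeriv hw 0 t)
    have h2 := rab_hasDeriv hu 1 t
    have h3 : iteratedDeriv 1 u = id * iteratedDeriv 0 w := by
      funext t; simp [iteratedDeriv_one, ← h]
    rw [h3] at h2
    have := h1.unique h2
    simp at this ⊢
    linarith
  | succ n ih =>
    intro t
    have h1 := ((hasDerivAt_id t).mul (rab_hasDeriv hw (n+1) t)).add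
      ((rab_hasDeriv hw n t).const_mul ((n:ℝ)+1))
    have h2 := rab_hasDeriv hu (n+2) t
    have h3 : iteratedDeriv (n+2) u = id * iteratedDeriv (n+1) w +
      fun t => ((n:ℝ)+1) * iteratedDeriv n w t := by
      funext t; simp [← ih]
    rw [h3] at h2
    have := h1.unique h2
    simp at this ⊢
    linarith

lemma rab_bound {u w : ℝ → ℝ} (hu : ∀ x, AnalyticAt ℝ u x) (hw : ∀ x, AnalyticAt ℝ w x)
    (h : ∀ t, t * w t = deriv u t) (n : ℕ) {r M : ℝ}
    (hM : ∀ t ∈ Set.Icc (0:ℝ) r, |iteratedDeriv (n+2) u t| ≤ M) :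
    ∀ t ∈ Set.Icc (0:ℝ) r, |iteratedDeriv n w t| ≤ M := by
  intro t ht
  have hM0 : 0 ≤ M := (abs_nonneg _).trans (hM t ht)
  have hode := rab_ode hu hw h n
  have key : (n+1) * |t ^ (n+1) * iteratedDeriv n w t| ≤ M * t ^ (n+1) := by
    have hd : ∀ s, HasDerivAt (fun s => (n+1) * (s ^ (n+1) * iteratedDeriv n w s))
        ((n+1) * (s ^ n * iteratedDeriv (n+2) u s)) s := by
      intro s
      have := (((hasDerivAt_pow (n+1) s).mul (rab_hasDeriv hw n s)).const_mul ((n:ℝ)+1))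
      refine this.congr_deriv ?_
      rw [← hode]
      push_cast
      ring
    have hB : ∀ s, HasDerivAt (fun s => M * s ^ (n+1)) (M * ((n+1) * s ^ n)) s := by
      intro s
      simpa using (hasDerivAt_pow (n+1) s).const_mul M
    have := image_norm_le_of_norm_deriv_right_le_deriv_boundary (a := 0) (b := r)
      (f := fun s => (n+1) * (s ^ (n+1) * iteratedDeriv n w s))
      (f' := fun s => (n+1) * (s ^ n * iteratedDeriv (n+2) u s))
      (B := fun s => M * s ^ (n+1)) (B' := fun s => M * ((n+1) * s ^ n))
      (fun s _ => (hd s).continuousAt.continuousWithinAt)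
      (fun s _ => (hd s).hasDerivWithinAt) (by simp)
      (hB) (fun s hs => ?_) ht
    · have h1 : (0:ℝ) ≤ n + 1 := by positivity
      simp only [Real.norm_eq_abs] at this
      rwa [abs_mul, abs_of_nonneg h1] at this
    · have h1 : (0:ℝ) ≤ n + 1 := by positivity
      have h2 : 0 ≤ s ^ n := pow_nonneg hs.1 n
      simp only [Real.norm_eq_abs]
      rw [abs_mul, abs_of_nonneg h1, abs_mul, abs_of_nonneg h2]
      have := mul_le_mul_of_nonneg_left (hM s ⟨hs.1, hs.2.le⟩) (mul_nonneg h1 h2)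
      linarith
  have hn : (1:ℝ) ≤ n + 1 := by linarith [Nat.cast_nonneg (α := ℝ) n]
  rcases ht.1.eq_or_lt with h0 | h0
  · have h1 := hode t
    have h2 := hM t ht
    rw [← h1, ← h0, zero_mul, zero_add, abs_mul, abs_of_nonneg (by linarith)] at h2
    rw [← h0]
    nlinarith [abs_nonneg (iteratedDeriv n w 0)]
  · have hp : 0 < t ^ (n+1) := pow_pos h0 _
    rw [abs_mul, abs_of_pos hp] at key
    have : t ^ (n+1) * |iteratedDeriv n w t| ≤ t ^ (n+1) * M := by
      nlinarith [mul_nonneg hp.le (abs_nonneg (iteratedDeriv n w t))]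
    exact le_of_mul_le_mul_left this hp

lemma rab_fderiv {E : Type*} [NormedAddCommGroup E] [InnerProductSpace ℝ E]
    {u w : ℝ → ℝ} (hu : ∀ x, AnalyticAt ℝ u x)
    (h : ∀ t, t * w t = deriv u t) :
    fderiv ℝ (fun y : E => u ‖y‖) = fun y => w ‖y‖ • innerSL ℝ y := by
  funext x
  apply HasFDerivAt.fderiv
  by_cases hx : x = 0
  · subst hx
    have h0 : HasDerivAt u 0 0 := by
      have := (hu 0).differentiableAt.hasDerivAt
      rwa [← h, zero_mul] at this
    rw [hasDerivAt_iff_isLittleO] at h0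
    simp only [map_zero, smul_zero]
    rw [hasFDerivAt_iff_isLittleO]
    have ht : Filter.Tendsto (fun y : E => ‖y‖) (nhds 0) (nhds 0) := by
      simpa using (continuous_norm (E := E)).tendsto 0
    have := h0.comp_tendsto ht
    simp [Function.comp_def] at this
    simpa using Asymptotics.isLittleO_norm_right.1 this
  · have hn : HasFDerivAt (fun y : E => ‖y‖) (‖x‖⁻¹ • innerSL ℝ x) x := by
      have h1 := (hasStrictFDerivAt_norm_sq x).hasFDerivAt.sqrt (by simpa using hx)
      simp only [Real.sqrt_sq (norm_nonneg _)] at h1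
      refine h1.congr_fderiv ?_
      ext y
      simp
      field_simp
    have h2 := (hu ‖x‖).differentiableAt.hasDerivAt.comp_hasFDerivAt x hn
    refine h2.congr_fderiv ?_
    rw [← h, smul_smul]
    congr 1
    have : ‖x‖ ≠ 0 := by simpa using hx
    field_simp

lemma rab_inner {E : Type*} [NormedAddCommGroup E] [InnerProductSpace ℝ E] (k : ℕ) (x : E) {r : ℝ}
    (hx : ‖x‖ ≤ r) : ‖iteratedFDeriv ℝ k (fun y : E => innerSL ℝ y) x‖ ≤ max 1 r := by
  rcases k with _ | k
  · rw [norm_iteratedFDeriv_zero, innerSL_apply_norm]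
    exact hx.trans (le_max_right _ _)
  · have hf : fderiv ℝ (fun y : E => innerSL ℝ y) = fun _ => (innerSL ℝ : E →L[ℝ] E →L[ℝ] ℝ) := by
      funext y
      exact (innerSL ℝ : E →L[ℝ] E →L[ℝ] ℝ).fderiv
    rw [← norm_iteratedFDeriv_fderiv, hf]
    rcases k with _ | k
    · rw [norm_iteratedFDeriv_zero]
      exact (norm_innerSL_le _).trans (le_max_left _ _)
    · rw [iteratedFDeriv_succ_const]
      simp

lemma rab_main (E : Type*) [NormedAddCommGroup E] [InnerProductSpace ℝ E] (q : ℕ) :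
    ∃ C : ℝ, 1 ≤ C ∧ ∀ i ≤ q, ∀ u : ℝ → ℝ, (∀ x : ℝ, AnalyticAt ℝ u x) →
      (∀ t : ℝ, u (-t) = u t) → ∀ r : ℝ, 0 < r → ∀ M : ℝ,
        (∀ ℓ ≤ 2 * i, ∀ t ∈ Set.Icc (0:ℝ) r, |iteratedDeriv ℓ u t| ≤ M) →
        ∀ x : E, ‖x‖ ≤ r →
          ‖iteratedFDeriv ℝ i (fun y : E => u ‖y‖) x‖ ≤ C * (max 1 r) ^ i * M := by
  induction q with
  | zero =>
    refine ⟨1, le_rfl, ?_⟩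
    intro i hi u hu he r hr M hM x hx
    obtain rfl : i = 0 := by omega
    have := hM 0 le_rfl ‖x‖ ⟨norm_nonneg _, hx⟩
    simpa using this
  | succ q ih =>
    obtain ⟨C, hC, ih⟩ := ih
    refine ⟨2 ^ q * C, one_le_mul_of_one_le_of_one_le (one_le_pow₀ (by norm_num)) hC, ?_⟩
    intro i hi u hu he r hr M hM x hx
    have hM0 : 0 ≤ M := (abs_nonneg _).trans (hM 0 (by omega) 0 ⟨le_rfl, hr.le⟩)
    have hm : 1 ≤ max 1 r := le_max_left _ _
    have h2 : (1:ℝ) ≤ 2 ^ q := one_le_pow₀ (by norm_num)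
    rcases Nat.lt_or_ge q i with hq | hq
    · obtain rfl : i = q + 1 := by omega
      obtain ⟨w, hw, hwe, hwu⟩ := rab_w hu he
      rw [← norm_iteratedFDeriv_fderiv, rab_fderiv hu hwu]
      have hf : ContDiff ℝ q (fun y : E => w ‖y‖) :=
        contDiff_iff_contDiffAt.2 fun y => (rab_analytic hw hwe y).contDiffAt
      have hg : ContDiff ℝ q (fun y : E => innerSL ℝ y) :=
        (innerSL ℝ : E →L[ℝ] E →L[ℝ] ℝ).contDiff
      refine (norm_iteratedFDeriv_smul_le hf hg x le_rfl).trans ?_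
      calc _ ≤ ∑ j ∈ Finset.range (q+1), (q.choose j : ℝ) * (C * (max 1 r) ^ q * M) * max 1 r := by
            refine Finset.sum_le_sum fun j hj => ?_
            have hj : j ≤ q := by simpa [Nat.lt_succ_iff] using hj
            have h3 : ‖iteratedFDeriv ℝ j (fun y : E => w ‖y‖) x‖ ≤ C * (max 1 r) ^ q * M := by
              refine (ih j hj w hw hwe r hr M (fun ℓ hℓ =>
                rab_bound hu hw hwu ℓ (hM (ℓ+2) (by omega))) x hx).trans ?_
              gcongr
            gcongr
            exact rab_inner _ _ hx
        _ = 2 ^ q * C * (max 1 r) ^ (q+1) * M := by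
            rw [← Finset.sum_mul, ← Finset.sum_mul]
            have := Nat.sum_range_choose q
            have h4 : ∑ j ∈ Finset.range (q+1), (q.choose j : ℝ) = 2 ^ q := by exact_mod_cast this
            rw [h4]
            ring
    · refine (ih i hq u hu he r hr M hM x hx).trans ?_
      gcongr
      nlinarith

/-- For an even analytic `u : ℝ → ℝ`, the radial function `f(x) = u(|x|)` on `ℝ³` is
analytic, and for each `q` there is `C = C(q) > 0` with
`‖f‖_{C^q(B̄_r)} ≤ C · max{1, r^q} · ‖u‖_{C^{2q}([0,r])}` for all `r > 0`. -/
theorem radial_analytic_bound (q : ℕ) :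
    ∃ C : ℝ, 0 < C ∧
      ∀ u : ℝ → ℝ, (∀ x : ℝ, AnalyticAt ℝ u x) → (∀ t : ℝ, u (-t) = u t) →
        ((∀ x : EuclideanSpace ℝ (Fin 3),
            AnalyticAt ℝ (fun y : EuclideanSpace ℝ (Fin 3) => u ‖y‖) x) ∧
          ∀ r : ℝ, 0 < r → ∀ M : ℝ,
            (∀ ℓ ≤ 2 * q, ∀ t ∈ Set.Icc (0:ℝ) r, |iteratedDeriv ℓ u t| ≤ M) →
            ∀ i ≤ q, ∀ x ∈ Metric.closedBall (0 : EuclideanSpace ℝ (Fin 3)) r,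
              ‖iteratedFDeriv ℝ i (fun y : EuclideanSpace ℝ (Fin 3) => u ‖y‖) x‖
                ≤ C * max 1 (r ^ q) * M) := by
  obtain ⟨C, hC, h⟩ := rab_main (EuclideanSpace ℝ (Fin 3)) q
  refine ⟨C, by linarith, fun u hu he => ⟨fun x => rab_analytic hu he x, ?_⟩⟩
  intro r hr M hM i hi x hx
  have hM0 : 0 ≤ M := (abs_nonneg _).trans (hM 0 (by omega) 0 ⟨le_rfl, hr.le⟩)
  refine (h i hi u hu he r hr M (fun ℓ hℓ => hM ℓ (by omega)) x (by simpa using hx)).trans ?_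
  gcongr
  rcases le_total r 1 with h1 | h1
  · rw [max_eq_left h1, one_pow]
    exact le_max_left _ _
  · rw [max_eq_right h1]
    exact (pow_le_pow_right₀ h1 hi).trans (le_max_right _ _)
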